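/- arXiv:2101.05887 — 2 statements merged into one kernel-verified Lean document; each statement's English description precedes it below -/
import Mathlib

section
/- Let (Ω, 𝓜, μ) be a measure space satisfying condition (A1) and let G ⊆ L¹(Ω, μ) be the set of (classes of) integrable functions f with f(x) ≠ 0 for μ-almost every x. Then G is exactly the set of Gâteaux differentiability of the L¹(Ω, μ) norm φ: φ is Gâteaux differentiable at fᵗ̃ if and only if fᵗ̃ ∈ G, and in that case ∂_G φ(fᵗ̃)(h) = ∫_Ω sign(f(x))·h(x) dμ(x) for every h ∈ L¹(Ω, μ) and any representative f of fᵗ̃. -/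
open Filter Topology MeasureTheory

theorem tendsto_abs_add_mul_sub_div {a : ℝ} (ha : a ≠ 0) (b : ℝ) :
    Tendsto (fun t : ℝ => (|a + t * b| - |a|) / t) (𝓝[≠] (0 : ℝ)) (𝓝 (Real.sign a * b)) := by
  have habs : HasDerivAt (fun x : ℝ => |x|) (Real.sign a) (a + 0 * b) := by
    rw [zero_mul, add_zero]
    rcases lt_or_gt_of_ne ha with h | h
    · rw [Real.sign_of_neg h]
      exact hasDerivAt_abs_neg h
    · rw [Real.sign_of_pos h]
      exact hasDerivAt_abs_pos h
  have hlin : HasDerivAt (fun t : ℝ => a + t * b) b 0 := by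
    simpa using ((hasDerivAt_id (0 : ℝ)).mul_const b).const_add a
  have hcomp : HasDerivAt (fun t : ℝ => |a + t * b|) (Real.sign a * b) 0 := by
    simpa only [Function.comp_def] using habs.comp (0 : ℝ) hlin
  refine (hasDerivAt_iff_tendsto_slope_zero.1 hcomp).congr fun t => ?_
  simp [div_eq_inv_mul]

theorem norm_abs_add_mul_sub_div_le (a b t : ℝ) : ‖(|a + t * b| - |a|) / t‖ ≤ |b| := by
  rcases eq_or_ne t 0 with rfl | ht
  · simp
  · rw [norm_div, Real.norm_eq_abs, Real.norm_eq_abs, div_le_iff₀ (abs_pos.2 ht)]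
    calc |(|a + t * b| - |a|)| ≤ |a + t * b - a| := abs_abs_sub_abs_le_abs_sub _ _
      _ = |b| * |t| := by rw [add_sub_cancel_left, abs_mul, mul_comm]

theorem norm_Lp_add_smul_sub_norm {Ω : Type*} [MeasurableSpace Ω] {μ : Measure Ω}
    (g h : Lp ℝ 1 μ) (t : ℝ) :
    ‖g + t • h‖ - ‖g‖ = ∫ x, (|g x + t * h x| - |g x|) ∂μ := by
  have hg : Integrable g μ := L1.integrable_coeFn g
  have hh : Integrable h μ := L1.integrable_coeFn h
  have hgh : Integrable (fun x => |g x + t * h x|) μ := (hg.add (hh.const_mul t)).abs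
  rw [L1.norm_eq_integral_norm, L1.norm_eq_integral_norm, integral_sub hgh hg.abs]
  congr 1
  refine integral_congr_ae ?_
  filter_upwards [Lp.coeFn_add g (t • h), Lp.coeFn_smul t h] with x h₁ h₂
  rw [h₁, Pi.add_apply, h₂, Pi.smul_apply, smul_eq_mul, Real.norm_eq_abs]

theorem tendsto_norm_Lp_add_smul_sub_div {Ω : Type*} [MeasurableSpace Ω] {μ : Measure Ω}
    {g : Lp ℝ 1 μ} (hg0 : ∀ᵐ x ∂μ, g x ≠ 0) (h : Lp ℝ 1 μ) :
    Tendsto (fun t : ℝ => (‖g + t • h‖ - ‖g‖) / t) (𝓝[≠] (0 : ℝ))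
      (𝓝 (∫ x, Real.sign (g x) * h x ∂μ)) := by
  have hg : Integrable g μ := L1.integrable_coeFn g
  have hh : Integrable h μ := L1.integrable_coeFn h
  simp_rw [norm_Lp_add_smul_sub_norm, ← integral_div]
  refine tendsto_integral_filter_of_dominated_convergence (fun x => |h x|) ?_ ?_ hh.abs ?_
  · exact Eventually.of_forall fun t =>
      (((hg.add (hh.const_mul t)).abs.sub hg.abs).div_const t).aestronglyMeasurable
  · exact Eventually.of_forall fun t => Eventually.of_forall fun x =>
      norm_abs_add_mul_sub_div_le _ _ _
  · filter_upwards [hg0] with x hx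
    exact tendsto_abs_add_mul_sub_div hx _

theorem not_tendsto_abs_mul_div {m : ℝ} (hm : 0 < m) (c : ℝ) :
    ¬ Tendsto (fun t : ℝ => |t| * m / t) (𝓝[≠] (0 : ℝ)) (𝓝 c) := by
  intro H
  have hpos : Tendsto (fun _ : ℝ => m) (𝓝[>] (0 : ℝ)) (𝓝 c) := by
    refine (H.mono_left (nhdsWithin_mono 0 fun t (ht : 0 < t) => ht.ne')).congr' ?_
    filter_upwards [self_mem_nhdsWithin] with t (ht : 0 < t)
    rw [abs_of_pos ht, mul_div_cancel_left₀ _ ht.ne']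
  have hneg : Tendsto (fun _ : ℝ => -m) (𝓝[<] (0 : ℝ)) (𝓝 c) := by
    refine (H.mono_left (nhdsWithin_mono 0 fun t (ht : t < 0) => ht.ne)).congr' ?_
    filter_upwards [self_mem_nhdsWithin] with t (ht : t < 0)
    rw [abs_of_neg ht, neg_mul, neg_div, mul_div_cancel_left₀ _ ht.ne]
  have h₁ := tendsto_nhds_unique hpos tendsto_const_nhds
  have h₂ := tendsto_nhds_unique hneg tendsto_const_nhds
  linarith

theorem norm_Lp_add_smul_indicator_sub_norm {Ω : Type*} [MeasurableSpace Ω] {μ : Measure Ω}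
    (g : Lp ℝ 1 μ) {F : Set Ω} (hF : MeasurableSet F) (hμF : μ F ≠ ⊤) (hgF : ∀ x ∈ F, g x = 0)
    (t : ℝ) :
    ‖g + t • indicatorConstLp 1 hF hμF (1 : ℝ)‖ - ‖g‖ = |t| * μ.real F := by
  rw [norm_Lp_add_smul_sub_norm]
  have hae : (fun x => |g x + t * indicatorConstLp 1 hF hμF (1 : ℝ) x| - |g x|) =ᵐ[μ]
      F.indicator fun _ => |t| := by
    filter_upwards [indicatorConstLp_coeFn (p := 1) (hs := hF) (hμs := hμF) (c := (1 : ℝ))]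
      with x hx
    by_cases hxF : x ∈ F <;> simp [hx, hxF, hgF]
  rw [integral_congr_ae hae, integral_indicator_const _ hF, smul_eq_mul, mul_comm]

theorem ae_ne_zero_of_tendsto_norm_Lp_add_smul_sub_div {Ω : Type*} [MeasurableSpace Ω]
    {μ : Measure Ω}
    (hA1 : ∀ I : Set Ω, MeasurableSet I → μ I = ⊤ →
      ∃ F : Set Ω, F ⊆ I ∧ MeasurableSet F ∧ 0 < μ F ∧ μ F < ⊤)
    {g : Lp ℝ 1 μ} {u : Lp ℝ 1 μ → ℝ}
    (hu : ∀ h : Lp ℝ 1 μ,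
      Tendsto (fun t : ℝ => (‖g + t • h‖ - ‖g‖) / t) (𝓝[≠] (0 : ℝ)) (𝓝 (u h))) :
    ∀ᵐ x ∂μ, g x ≠ 0 := by
  by_contra hg0
  have hZ : MeasurableSet {x | g x = 0} :=
    (Lp.stronglyMeasurable g).measurable (measurableSet_singleton 0)
  have hμZ : μ {x | g x = 0} ≠ 0 := by simpa [ae_iff] using hg0
  obtain ⟨F, hFZ, hF, hF0, hFtop⟩ :
      ∃ F : Set Ω, F ⊆ {x | g x = 0} ∧ MeasurableSet F ∧ 0 < μ F ∧ μ F < ⊤ := by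
    by_cases htop : μ {x | g x = 0} = ⊤
    · exact hA1 _ hZ htop
    · exact ⟨_, subset_rfl, hZ, pos_iff_ne_zero.2 hμZ, lt_top_iff_ne_top.2 htop⟩
  refine not_tendsto_abs_mul_div (ENNReal.toReal_pos hF0.ne' hFtop.ne) _
    ((hu (indicatorConstLp 1 hF hFtop.ne (1 : ℝ))).congr fun t => ?_)
  rw [norm_Lp_add_smul_indicator_sub_norm g hF hFtop.ne hFZ, Measure.real]

theorem norm_sign_le_one (x : ℝ) : ‖Real.sign x‖ ≤ 1 := by
  rcases Real.sign_apply_eq x with h | h | h <;> simp [h]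

theorem measurable_real_sign : Measurable Real.sign :=
  Measurable.ite measurableSet_Iio measurable_const
    (Measurable.ite measurableSet_Ioi measurable_const measurable_const)

theorem integrable_sign_mul {Ω : Type*} [MeasurableSpace Ω] {μ : Measure Ω}
    (g h : Lp ℝ 1 μ) : Integrable (fun x => Real.sign (g x) * h x) μ :=
  (L1.integrable_coeFn h).bdd_mul
    (measurable_real_sign.comp (Lp.stronglyMeasurable g).measurable).aestronglyMeasurable
    (Eventually.of_forall fun x => norm_sign_le_one (g x))

/-- Integration against the signature of `g`, as a continuous linear functional on `L¹`. -/
noncomputable def integralSignMul {Ω : Type*} [MeasurableSpace Ω] {μ : Measure Ω}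
    (g : Lp ℝ 1 μ) : Lp ℝ 1 μ →L[ℝ] ℝ :=
  LinearMap.mkContinuous
    { toFun := fun h => ∫ x, Real.sign (g x) * h x ∂μ
      map_add' := fun h k => by
        rw [← integral_add (integrable_sign_mul g h) (integrable_sign_mul g k)]
        refine integral_congr_ae ?_
        filter_upwards [Lp.coeFn_add h k] with x hx
        rw [hx, Pi.add_apply, mul_add]
      map_smul' := fun c h => by
        rw [RingHom.id_apply, smul_eq_mul, ← integral_const_mul]
        refine integral_congr_ae ?_
        filter_upwards [Lp.coeFn_smul c h] with x hx
        rw [hx, Pi.smul_apply, smul_eq_mul, mul_left_comm] }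
    1 fun h => by
      rw [one_mul, L1.norm_eq_integral_norm]
      refine norm_integral_le_of_norm_le (L1.integrable_coeFn h).norm
        (Eventually.of_forall fun x => ?_)
      rw [norm_mul]
      exact mul_le_of_le_one_left (norm_nonneg _) (norm_sign_le_one _)

theorem stmt_9 {Ω : Type*} [MeasurableSpace Ω] (μ : Measure Ω)
    (hA1 : ∀ I : Set Ω, MeasurableSet I → μ I = ⊤ →
      ∃ F : Set Ω, F ⊆ I ∧ MeasurableSet F ∧ 0 < μ F ∧ μ F < ⊤)
    (g : Lp ℝ 1 μ) :
    ((∃ u : Lp ℝ 1 μ →L[ℝ] ℝ, ∀ h : Lp ℝ 1 μ,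
        Tendsto (fun t : ℝ => (‖g + t • h‖ - ‖g‖) / t) (𝓝[≠] (0 : ℝ)) (𝓝 (u h))) ↔
      (∀ᵐ x ∂μ, (g : Ω → ℝ) x ≠ 0)) ∧
    (∀ u : Lp ℝ 1 μ →L[ℝ] ℝ,
      (∀ h : Lp ℝ 1 μ,
        Tendsto (fun t : ℝ => (‖g + t • h‖ - ‖g‖) / t) (𝓝[≠] (0 : ℝ)) (𝓝 (u h))) →
      ∀ f : Ω → ℝ, f =ᵐ[μ] (g : Ω → ℝ) →
        ∀ h : Lp ℝ 1 μ, u h = ∫ x, Real.sign (f x) * h x ∂μ) := by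
  refine ⟨⟨fun ⟨u, hu⟩ => ae_ne_zero_of_tendsto_norm_Lp_add_smul_sub_div hA1 hu,
    fun hg0 => ⟨integralSignMul g, tendsto_norm_Lp_add_smul_sub_div hg0⟩⟩, ?_⟩
  intro u hu f hf h
  have hg0 := ae_ne_zero_of_tendsto_norm_Lp_add_smul_sub_div hA1 hu
  rw [tendsto_nhds_unique (hu h) (tendsto_norm_Lp_add_smul_sub_div hg0 h)]
  refine integral_congr_ae ?_
  filter_upwards [hf] with x hx
  rw [hx]
end

section
/- Let (Ω, 𝓜, μ) be a measure space satisfying condition (A1) such that the Banach space L¹(Ω, μ) is separable, and let G ⊆ L¹(Ω, μ) be the set of (classes of) integrable functions f with f(x) ≠ 0 for μ-almost every x. Then G is a dense Gδ subset of L¹(Ω, μ) (i.e., G is dense and is a countable intersection of open sets). -/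
open Filter Topology MeasureTheory

open scoped ENNReal NNReal

/-- If `L¹` is separable and every measurable set of infinite measure contains a measurable set of
finite positive measure, then the measure is σ-finite. -/
theorem sigmaFinite_of_separableSpace_L1 {Ω : Type*} [MeasurableSpace Ω] (μ : Measure Ω)
    (hA1 : ∀ I : Set Ω, MeasurableSet I → μ I = ⊤ →
      ∃ F : Set Ω, F ⊆ I ∧ MeasurableSet F ∧ 0 < μ F ∧ μ F < ⊤)
    [TopologicalSpace.SeparableSpace (Lp ℝ 1 μ)] : SigmaFinite μ := by
  let u := TopologicalSpace.denseSeq (Lp ℝ 1 μ)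
  let Z : Set Ω := ⋂ n, {x | u n x = 0}
  have hZm : MeasurableSet Z := MeasurableSet.iInter fun n =>
    (Lp.stronglyMeasurable (u n)).measurable (measurableSet_singleton 0)
  have hZ : μ Z < ⊤ := by
    by_contra hZ
    obtain ⟨F, hFZ, hFm, hF0, hFt⟩ := hA1 Z hZm (not_lt_top_iff.mp hZ)
    let f : Lp ℝ 1 μ := indicatorConstLp 1 hFm hFt.ne 1
    have hdist : ∀ n, μ F ≤ edist f (u n) := fun n => by
      rw [L1.edist_def, ← lintegral_indicator_one hFm]
      refine lintegral_mono_ae ?_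
      filter_upwards [indicatorConstLp_coeFn (p := 1) (hs := hFm) (hμs := hFt.ne) (c := (1 : ℝ))]
        with x hx
      by_cases hxF : x ∈ F
      · have h0 : u n x = 0 := Set.mem_iInter.mp (hFZ hxF) n
        rw [hx, h0]
        simp [hxF, edist_eq_enorm_sub]
      · simp [hxF]
    obtain ⟨n, hlt⟩ := (TopologicalSpace.denseRange_denseSeq (Lp ℝ 1 μ)).exists_mem_open
      (Metric.isOpen_eball (x := f) (ε := μ F)) ⟨f, Metric.mem_eball_self hF0⟩
    rw [Metric.mem_eball, edist_comm] at hlt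
    exact (hdist n).not_gt hlt
  refine Measure.sigmaFinite_of_countable
    (S := insert Z (Set.range fun p : ℕ × ℕ => {x | 1 / ((p.2 : ℝ) + 1) ≤ ‖u p.1 x‖}))
    ((Set.countable_range _).insert _) ?_ ?_
  · rintro _ (rfl | ⟨p, rfl⟩)
    · exact hZ
    · exact (L1.integrable_coeFn (u p.1)).measure_norm_ge_lt_top Nat.one_div_pos_of_nat
  · refine Set.eq_univ_of_forall fun x => ?_
    by_cases hx : x ∈ Z
    · exact ⟨Z, Set.mem_insert _ _, hx⟩
    · obtain ⟨n, hn⟩ : ∃ n, u n x ≠ 0 := by simpa [Z] using hx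
      obtain ⟨k, hk⟩ := exists_nat_one_div_lt (norm_pos_iff.mpr hn)
      exact ⟨_, Set.mem_insert_of_mem _ ⟨(n, k), rfl⟩, hk.le⟩

theorem dense_setOf_ae_ne_zero_L1 {Ω : Type*} [MeasurableSpace Ω] (μ : Measure Ω) [SigmaFinite μ] :
    Dense {g : Lp ℝ 1 μ | ∀ᵐ x ∂μ, (g : Ω → ℝ) x ≠ 0} := by
  refine EMetric.dense_iff.mpr fun f ε hε => ?_
  obtain ⟨w, hw0, hwm, hwε⟩ := exists_pos_lintegral_lt_of_sigmaFinite μ hε.ne'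
  have hwi : Integrable (fun x => (w x : ℝ)) μ := by
    refine ⟨hwm.coe_nnreal_real.aestronglyMeasurable, ?_⟩
    simpa [HasFiniteIntegral] using hwε.trans_le le_top
  have hZ : MeasurableSet {x | f x = 0} :=
    (Lp.stronglyMeasurable f).measurable (measurableSet_singleton 0)
  have hi := hwi.indicator hZ
  have hadd := Lp.coeFn_add f (hi.toL1 _)
  refine ⟨f + hi.toL1 _, ?_, ?_⟩
  · rw [Metric.mem_eball, edist_comm, L1.edist_def]
    refine lt_of_le_of_lt (lintegral_mono_ae ?_) hwε
    filter_upwards [hadd, hi.coeFn_toL1] with x hx hx'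
    rw [hx, Pi.add_apply, hx', edist_eq_enorm_sub]
    by_cases h : f x = 0 <;> simp [h]
  · filter_upwards [hadd, hi.coeFn_toL1] with x hx hx'
    rw [hx, Pi.add_apply, hx']
    by_cases h : f x = 0
    · simp [h, (hw0 x).ne']
    · simp [h]

theorem integrable_max_sub_mul_abs {Ω : Type*} [MeasurableSpace Ω] {μ : Measure Ω} {w : Ω → ℝ}
    (hw : Integrable w μ) (c : ℝ) (g : Lp ℝ 1 μ) :
    Integrable (fun x => max (w x - c * |g x|) 0) μ :=
  (hw.sub ((L1.integrable_coeFn g).abs.const_mul c)).pos_part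

theorem continuous_integral_max_sub_mul_abs {Ω : Type*} [MeasurableSpace Ω] {μ : Measure Ω}
    {w : Ω → ℝ} (hw : Integrable w μ) (c : ℝ) :
    Continuous fun g : Lp ℝ 1 μ => ∫ x, max (w x - c * |g x|) 0 ∂μ := by
  have hcont : Continuous fun g : Lp ℝ 1 μ => ‖(hw.toL1 w - c • (g ⊔ -g)) ⊔ 0‖ :=
    ((continuous_const.sub ((continuous_id.sup continuous_neg).const_smul c)).sup
      continuous_const).norm
  refine hcont.congr fun g => ?_
  rw [L1.norm_eq_integral_norm]
  refine integral_congr_ae ?_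
  filter_upwards [Lp.coeFn_sup (hw.toL1 w - c • (g ⊔ -g)) 0, Lp.coeFn_zero ℝ 1 μ,
    Lp.coeFn_sub (hw.toL1 w) (c • (g ⊔ -g)), Lp.coeFn_smul c (g ⊔ -g),
    Lp.coeFn_sup g (-g), Lp.coeFn_neg g, hw.coeFn_toL1] with x h1 h2 h3 h4 h5 h6 h7
  rw [h1, Pi.sup_apply, h2, h3, Pi.sub_apply, h4, Pi.smul_apply, h5, Pi.sup_apply, h6, h7]
  exact Real.norm_of_nonneg (le_max_right _ _)

theorem isGδ_setOf_ae_ne_zero_L1 {Ω : Type*} [MeasurableSpace Ω] (μ : Measure Ω) [SigmaFinite μ] :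
    IsGδ {g : Lp ℝ 1 μ | ∀ᵐ x ∂μ, (g : Ω → ℝ) x ≠ 0} := by
  obtain ⟨w, hw0, hwm, hwε⟩ := exists_pos_lintegral_lt_of_sigmaFinite μ one_ne_zero
  have hwi : Integrable (fun x => (w x : ℝ)) μ := by
    refine ⟨hwm.coe_nnreal_real.aestronglyMeasurable, ?_⟩
    simpa [HasFiniteIntegral] using hwε.trans_le le_top
  have heq : {g : Lp ℝ 1 μ | ∀ᵐ x ∂μ, (g : Ω → ℝ) x ≠ 0} =
      ⋂ n : ℕ, ⋃ m : ℕ,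
        {g : Lp ℝ 1 μ | ∫ x, max (w x - (m : ℝ) * |g x|) 0 ∂μ < 1 / ((n : ℝ) + 1)} := by
    ext g
    simp only [Set.mem_ofPred_eq, Set.mem_iInter, Set.mem_iUnion]
    constructor
    · intro hg n
      have hlim : Tendsto (fun m : ℕ => ∫ x, max (w x - (m : ℝ) * |g x|) 0 ∂μ) atTop (𝓝 0) := by
        rw [show 𝓝 (0 : ℝ) = 𝓝 (∫ _, 0 ∂μ) by rw [integral_zero]]
        refine tendsto_integral_of_dominated_convergence (fun x => (w x : ℝ))
          (fun m => (integrable_max_sub_mul_abs hwi m g).aestronglyMeasurable) hwi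
          (fun m => .of_forall fun x => ?_) ?_
        · rw [Real.norm_of_nonneg (le_max_right _ _)]
          exact max_le (sub_le_self _ (by positivity)) (w x).coe_nonneg
        · filter_upwards [hg] with x hx
          obtain ⟨k, hk⟩ := exists_nat_ge (w x / |g x|)
          refine tendsto_const_nhds.congr' ?_
          filter_upwards [eventually_ge_atTop k] with m hm
          have hwm : (w x : ℝ) ≤ m * |g x| :=
            (div_le_iff₀ (abs_pos.mpr hx)).mp (hk.trans (Nat.cast_le.mpr hm))
          exact (max_eq_right (sub_nonpos.mpr hwm)).symm
      exact (hlim.eventually_lt_const Nat.one_div_pos_of_nat).exists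
    · intro hg
      have hZ : MeasurableSet {x | g x = 0} :=
        (Lp.stronglyMeasurable g).measurable (measurableSet_singleton 0)
      have hi := hwi.indicator hZ
      have hnn : 0 ≤ {x | g x = 0}.indicator (fun x => (w x : ℝ)) :=
        Set.indicator_nonneg fun x _ => (w x).coe_nonneg
      have hle : ∀ m : ℕ, ∫ x, {x | g x = 0}.indicator (fun x => (w x : ℝ)) x ∂μ ≤
          ∫ x, max (w x - (m : ℝ) * |g x|) 0 ∂μ := fun m => by
          refine integral_mono hi (integrable_max_sub_mul_abs hwi m g) fun x => ?_
          by_cases h : g x = 0 <;> simp [h]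
      have hzero : ∫ x, {x | g x = 0}.indicator (fun x => (w x : ℝ)) x ∂μ = 0 := by
        refine le_antisymm (le_of_forall_pos_le_add fun ε hε => ?_) (integral_nonneg hnn)
        obtain ⟨n, hn⟩ := exists_nat_one_div_lt hε
        obtain ⟨m, hm⟩ := hg n
        simpa using (hle m).trans (hm.trans hn).le
      filter_upwards [(integral_eq_zero_iff_of_nonneg hnn hi).mp hzero] with x hx hgx
      simp [hgx, (hw0 x).ne'] at hx
  rw [heq]
  exact .iInter_of_isOpen fun n => isOpen_iUnion fun m =>
    isOpen_lt (continuous_integral_max_sub_mul_abs hwi m) continuous_const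

theorem stmt_12 {Ω : Type*} [MeasurableSpace Ω] (μ : Measure Ω)
    (hA1 : ∀ I : Set Ω, MeasurableSet I → μ I = ⊤ →
      ∃ F : Set Ω, F ⊆ I ∧ MeasurableSet F ∧ 0 < μ F ∧ μ F < ⊤)
    [TopologicalSpace.SeparableSpace (Lp ℝ 1 μ)] :
    Dense {g : Lp ℝ 1 μ | ∀ᵐ x ∂μ, (g : Ω → ℝ) x ≠ 0} ∧
    IsGδ {g : Lp ℝ 1 μ | ∀ᵐ x ∂μ, (g : Ω → ℝ) x ≠ 0} := by
  have := sigmaFinite_of_separableSpace_L1 μ hA1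
  exact ⟨dense_setOf_ae_ne_zero_L1 μ, isGδ_setOf_ae_ne_zero_L1 μ⟩
end
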